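/- arXiv:1701.06084 — 2 statements merged into one kernel-verified Lean document; each statement's English description precedes it below -/
import Mathlib

section
/- (Positivity of the exponent α3) Let Y be a finite alphabet and let π and μ be distinct pmfs on Y with full support. Then the infimum, over triples of pmfs (q1, q2, q3) on Y satisfying D(q1‖q2) > D(q3‖q2), of D(q1‖π) + D(q2‖π) + D(q3‖μ), is strictly positive. -/
open scoped BigOperators

/-- A probability mass function on a finite alphabet `Y`. -/
def IsPmf {Y : Type*} [Fintype Y] (p : Y → ℝ) : Prop :=
  (∀ y, 0 ≤ p y) ∧ ∑ y, p y = 1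

/-- KL divergence `D(p‖q)`, valued in the extended reals: it is `+∞` when the
support of `p` is not contained in that of `q`. -/
noncomputable def KL {Y : Type*} [Fintype Y] (p q : Y → ℝ) : EReal :=
  if ∀ y, q y = 0 → p y = 0 then ((∑ y, p y * Real.log (p y / q y) : ℝ) : EReal) else ⊤

/-- Bhattacharyya distance `B(p,q) = −log( Σ_y √(p y) √(q y) )`. -/
noncomputable def Bhat {Y : Type*} [Fintype Y] (p q : Y → ℝ) : ℝ :=
  - Real.log (∑ y, Real.sqrt (p y) * Real.sqrt (q y))

open Filter Topology InformationTheory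

/-- Against a full-support reference, `KL` is the real-valued sum. -/
theorem KL_of_pos {Y : Type*} [Fintype Y] {p q : Y → ℝ} (hq : ∀ y, 0 < q y) :
    KL p q = ((∑ y, p y * Real.log (p y / q y) : ℝ) : EReal) :=
  if_pos fun y h => absurd h (hq y).ne'

/-- Between pmfs, the divergence sum is a sum of nonnegative `klFun` terms. -/
theorem sum_mul_log_div_eq_sum_klFun {Y : Type*} [Fintype Y] {p q : Y → ℝ}
    (hp : IsPmf p) (hq : IsPmf q) (hq0 : ∀ y, 0 < q y) :
    ∑ y, p y * Real.log (p y / q y) = ∑ y, q y * klFun (p y / q y) := by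
  have h : ∀ y, q y * klFun (p y / q y) = p y * Real.log (p y / q y) + (q y - p y) := by
    intro y
    have := (hq0 y).ne'
    unfold klFun
    field_simp
    ring
  simp only [h, Finset.sum_add_distrib, Finset.sum_sub_distrib, hp.2, hq.2]
  ring

theorem sum_mul_log_div_nonneg {Y : Type*} [Fintype Y] {p q : Y → ℝ}
    (hp : IsPmf p) (hq : IsPmf q) (hq0 : ∀ y, 0 < q y) :
    0 ≤ ∑ y, p y * Real.log (p y / q y) := by
  rw [sum_mul_log_div_eq_sum_klFun hp hq hq0]
  exact Finset.sum_nonneg fun y _ =>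
    mul_nonneg (hq0 y).le (klFun_nonneg (div_nonneg (hp.1 y) (hq0 y).le))

/-- Gibbs' inequality, equality case. -/
theorem eq_of_sum_mul_log_div_eq_zero {Y : Type*} [Fintype Y] {p q : Y → ℝ}
    (hp : IsPmf p) (hq : IsPmf q) (hq0 : ∀ y, 0 < q y)
    (h : ∑ y, p y * Real.log (p y / q y) = 0) : p = q := by
  rw [sum_mul_log_div_eq_sum_klFun hp hq hq0, Finset.sum_eq_zero_iff_of_nonneg fun y _ =>
    mul_nonneg (hq0 y).le (klFun_nonneg (div_nonneg (hp.1 y) (hq0 y).le))] at h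
  funext y
  have hy := (mul_eq_zero.1 (h y (Finset.mem_univ y))).resolve_left (hq0 y).ne'
  rw [klFun_eq_zero_iff (div_nonneg (hp.1 y) (hq0 y).le)] at hy
  exact (div_eq_one_iff_eq (hq0 y).ne').1 hy

theorem continuous_sum_mul_log_div {Y : Type*} [Fintype Y] {q : Y → ℝ} (hq0 : ∀ y, 0 < q y) :
    Continuous fun p : Y → ℝ => ∑ y, p y * Real.log (p y / q y) := by
  refine continuous_finsetSum _ fun y _ => ?_
  have h : (fun p : Y → ℝ => p y * Real.log (p y / q y)) =
      fun p => q y * ((p y / q y) * Real.log (p y / q y)) := by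
    funext p
    have := (hq0 y).ne'
    field_simp
  rw [h]
  exact continuous_const.mul
    (Real.continuous_mul_log.comp (by fun_prop : Continuous fun p : Y → ℝ => p y / q y))

theorem continuousAt_sum_mul_log_div {Y X : Type*} [Fintype Y] [TopologicalSpace X]
    {f g : X → Y → ℝ} {x : X} (hf : Continuous f) (hg : Continuous g)
    (hf0 : ∀ y, 0 < f x y) (hg0 : ∀ y, 0 < g x y) :
    ContinuousAt (fun z => ∑ y, f z y * Real.log (f z y / g z y)) x := by
  refine tendsto_finsetSum _ fun y _ => ?_
  have h1 : ContinuousAt (fun z => f z y) x := ((continuous_apply y).comp hf).continuousAt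
  have h2 : ContinuousAt (fun z => g z y) x := ((continuous_apply y).comp hg).continuousAt
  exact h1.mul ((h1.div h2 (hg0 y).ne').log (div_pos (hf0 y) (hg0 y)).ne')

theorem isCompact_setOf_isPmf {Y : Type*} [Fintype Y] : IsCompact {p : Y → ℝ | IsPmf p} :=
  isCompact_stdSimplex ℝ Y

/-- Near `(π, π, μ)` the divergence to the second argument is larger from the third than from
the first. -/
theorem eventually_KL_le {Y : Type*} [Fintype Y] {π μ : Y → ℝ} (hπ : IsPmf π) (hμ : IsPmf μ)
    (hπf : ∀ y, 0 < π y) (hμf : ∀ y, 0 < μ y) (hne : π ≠ μ) :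
    ∀ᶠ x : (Y → ℝ) × (Y → ℝ) × (Y → ℝ) in 𝓝 (π, π, μ), KL x.1 x.2.1 ≤ KL x.2.2 x.2.1 := by
  have hpos : ∀ᶠ x : (Y → ℝ) × (Y → ℝ) × (Y → ℝ) in 𝓝 (π, π, μ), ∀ y, 0 < x.2.1 y :=
    eventually_all.2 fun y => ContinuousAt.eventually_lt continuousAt_const
      (by fun_prop : ContinuousAt (fun x : (Y → ℝ) × (Y → ℝ) × (Y → ℝ) => x.2.1 y) (π, π, μ))
      (hπf y)
  have hzero : ∑ y, π y * Real.log (π y / π y) = 0 := by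
    simp [div_self (hπf _).ne']
  have hlt : 0 < ∑ y, μ y * Real.log (μ y / π y) :=
    (sum_mul_log_div_nonneg hμ hπ hπf).lt_of_ne' fun h =>
      hne (eq_of_sum_mul_log_div_eq_zero hμ hπ hπf h).symm
  have hev := ContinuousAt.eventually_lt
    (continuousAt_sum_mul_log_div (f := fun x : (Y → ℝ) × (Y → ℝ) × (Y → ℝ) => x.1)
      (g := fun x => x.2.1) (x := (π, π, μ)) (by fun_prop) (by fun_prop) hπf hπf)
    (continuousAt_sum_mul_log_div (f := fun x : (Y → ℝ) × (Y → ℝ) × (Y → ℝ) => x.2.2)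
      (g := fun x => x.2.1) (x := (π, π, μ)) (by fun_prop) (by fun_prop) hμf hπf)
    (by simpa only [hzero] using hlt)
  filter_upwards [hpos, hev] with x hx hx'
  rw [KL_of_pos hx, KL_of_pos hx]
  exact EReal.coe_le_coe_iff.2 hx'.le

/-- positivity of the exponent α3. For distinct full-support
pmfs `π` and `μ`, the infimum over pmf triples `(q1,q2,q3)` satisfying
`D(q1‖q2) > D(q3‖q2)` of `D(q1‖π) + D(q2‖π) + D(q3‖μ)` is strictly positive. -/
theorem alpha3_pos {Y : Type*} [Fintype Y] [Nonempty Y]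
    (π μ : Y → ℝ) (hπ : IsPmf π) (hμ : IsPmf μ)
    (hπf : ∀ y, 0 < π y) (hμf : ∀ y, 0 < μ y) (hne : π ≠ μ) :
    0 < sInf {r : EReal | ∃ q1 q2 q3 : Y → ℝ,
      IsPmf q1 ∧ IsPmf q2 ∧ IsPmf q3 ∧
      KL q3 q2 < KL q1 q2 ∧
      r = KL q1 π + KL q2 π + KL q3 μ} := by
  obtain ⟨U, hU, hUo, hmem⟩ := eventually_nhds_iff.1 (eventually_KL_le hπ hμ hπf hμf hne)
  let F : (Y → ℝ) × (Y → ℝ) × (Y → ℝ) → ℝ := fun x =>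
    ∑ y, x.1 y * Real.log (x.1 y / π y) + ∑ y, x.2.1 y * Real.log (x.2.1 y / π y) +
      ∑ y, x.2.2 y * Real.log (x.2.2 y / μ y)
  have hF : Continuous F :=
    (((continuous_sum_mul_log_div hπf).comp continuous_fst).add
      ((continuous_sum_mul_log_div hπf).comp (continuous_fst.comp continuous_snd))).add
      ((continuous_sum_mul_log_div hμf).comp (continuous_snd.comp continuous_snd))
  have hK : IsCompact (({p : Y → ℝ | IsPmf p} ×ˢ {p : Y → ℝ | IsPmf p} ×ˢ
      {p : Y → ℝ | IsPmf p}) \ U) :=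
    (isCompact_setOf_isPmf.prod (isCompact_setOf_isPmf.prod isCompact_setOf_isPmf)).diff hUo
  obtain ⟨m, hm, hmF⟩ := hK.exists_forall_le' (a := 0) hF.continuousOn (by
    rintro ⟨q1, q2, q3⟩ ⟨⟨h1, h2, h3⟩, hq⟩
    change IsPmf q1 at h1
    change IsPmf q2 at h2
    change IsPmf q3 at h3
    have n1 := sum_mul_log_div_nonneg h1 hπ hπf
    have n2 := sum_mul_log_div_nonneg h2 hπ hπf
    have n3 := sum_mul_log_div_nonneg h3 hμ hμf
    refine (add_nonneg (add_nonneg n1 n2) n3).lt_of_ne' fun h => hq ?_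
    rw [eq_of_sum_mul_log_div_eq_zero h1 hπ hπf (by linarith),
      eq_of_sum_mul_log_div_eq_zero h2 hπ hπf (by linarith),
      eq_of_sum_mul_log_div_eq_zero h3 hμ hμf (by linarith)]
    exact hmem)
  refine (EReal.coe_pos.2 hm).trans_le (le_sInf ?_)
  rintro r ⟨q1, q2, q3, h1, h2, h3, hlt, rfl⟩
  rw [KL_of_pos hπf, KL_of_pos hπf, KL_of_pos hμf, ← EReal.coe_add, ← EReal.coe_add,
    EReal.coe_le_coe_iff]
  exact hmF (q1, q2, q3) ⟨⟨h1, h2, h3⟩, fun hq => (hU _ hq).not_gt hlt⟩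
end

section
/- (Positivity of the exponent α9 under the clustering condition) Let Y be a finite alphabet, let S and T be nonempty finite index sets, and let μ_i (i ∈ S) and π_j (j ∈ T) be pmfs on Y with full support satisfying the clustering condition: max_{i,i'∈S} D(μ_i‖μ_{i'}) < min_{i∈S, j∈T} min{ D(μ_i‖π_j), D(π_j‖μ_i) } and max_{j,j'∈T} D(π_j‖π_{j'}) < min_{i∈S, j∈T} min{ D(μ_i‖π_j), D(π_j‖μ_i) }. Then the infimum, over j1, j2 ∈ T, i ∈ S, and triples of pmfs (q1, q2, q3) on Y satisfying D(q1‖q2) > D(q1‖q3), of D(q1‖π_{j1}) + D(q2‖π_{j2}) + D(q3‖μ_i), is strictly positive. -/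
open scoped BigOperators

open Filter Topology

/-- The real-valued divergence sum, which agrees with `KL` when the second argument has full
support. -/
noncomputable def klSum {Y : Type*} [Fintype Y] (p q : Y → ℝ) : ℝ :=
  ∑ y, p y * Real.log (p y / q y)

theorem KL_eq_klSum {Y : Type*} [Fintype Y] (p : Y → ℝ) {q : Y → ℝ} (hq : ∀ y, 0 < q y) :
    KL p q = (klSum p q : EReal) :=
  if_pos fun y h => absurd h (hq y).ne'

theorem sq_sqrt_sub_sqrt_le {a b : ℝ} (ha : 0 ≤ a) (hb : 0 < b) :
    (√a - √b) ^ 2 ≤ a * Real.log (a / b) - a + b := by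
  rcases ha.eq_or_lt with rfl | ha'
  · simp [Real.sq_sqrt hb.le]
  have hsa := Real.sqrt_pos.2 ha'
  have hsb := Real.sqrt_pos.2 hb
  have hlog : Real.log (a / b) = -(2 * Real.log (√b / √a)) := by
    rw [Real.log_div ha'.ne' hb.ne', Real.log_div hsb.ne' hsa.ne', Real.log_sqrt hb.le,
      Real.log_sqrt ha]
    ring
  have hle := mul_le_mul_of_nonneg_left (Real.log_le_sub_one_of_pos (div_pos hsb hsa)) ha
  have hmul : a * (√b / √a) = √a * √b := by
    nth_rewrite 1 [← Real.mul_self_sqrt ha]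
    field_simp
  rw [hlog]
  nlinarith [Real.sq_sqrt ha, Real.sq_sqrt hb.le]

theorem IsPmf.le_one {Y : Type*} [Fintype Y] {p : Y → ℝ} (hp : IsPmf p) (y : Y) : p y ≤ 1 :=
  hp.2 ▸ Finset.single_le_sum (fun z _ => hp.1 z) (Finset.mem_univ y)

/-- A Pinsker-type inequality, through the Hellinger distance. -/
theorem sq_sub_le_klSum {Y : Type*} [Fintype Y] {p q : Y → ℝ} (hp : IsPmf p) (hq : IsPmf q)
    (hqf : ∀ y, 0 < q y) (y : Y) : (p y - q y) ^ 2 ≤ 4 * klSum p q := by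
  have hsum : ∑ z, (√(p z) - √(q z)) ^ 2 ≤ klSum p q :=
    calc ∑ z, (√(p z) - √(q z)) ^ 2
        ≤ ∑ z, (p z * Real.log (p z / q z) - p z + q z) :=
          Finset.sum_le_sum fun z _ => sq_sqrt_sub_sqrt_le (hp.1 z) (hqf z)
      _ = klSum p q := by
          rw [Finset.sum_add_distrib, Finset.sum_sub_distrib, hp.2, hq.2, klSum]
          ring
  have hterm : (√(p y) - √(q y)) ^ 2 ≤ klSum p q :=
    (Finset.single_le_sum (f := fun z => (√(p z) - √(q z)) ^ 2)
      (fun z _ => sq_nonneg _) (Finset.mem_univ y)).trans hsum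
  have hsp : √(p y) ≤ 1 := Real.sqrt_le_one.2 (hp.le_one y)
  have hsq : √(q y) ≤ 1 := Real.sqrt_le_one.2 (hq.le_one y)
  have hfac : (p y - q y) ^ 2 = (√(p y) - √(q y)) ^ 2 * (√(p y) + √(q y)) ^ 2 := by
    nth_rewrite 1 [← Real.sq_sqrt (hp.1 y), ← Real.sq_sqrt (hq.1 y)]
    ring
  have hfour : (√(p y) + √(q y)) ^ 2 ≤ 4 := by
    nlinarith [Real.sqrt_nonneg (p y), Real.sqrt_nonneg (q y)]
  nlinarith [sq_nonneg (√(p y) - √(q y))]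

theorem klSum_nonneg {Y : Type*} [Fintype Y] [Nonempty Y] {p q : Y → ℝ} (hp : IsPmf p)
    (hq : IsPmf q) (hqf : ∀ y, 0 < q y) : 0 ≤ klSum p q := by
  obtain ⟨y⟩ := ‹Nonempty Y›
  nlinarith [sq_sub_le_klSum hp hq hqf y, sq_nonneg (p y - q y)]

theorem dist_lt_of_klSum_lt {Y : Type*} [Fintype Y] {p q : Y → ℝ} (hp : IsPmf p) (hq : IsPmf q)
    (hqf : ∀ y, 0 < q y) {δ : ℝ} (hδ : 0 < δ) (h : klSum p q < δ ^ 2 / 4) : dist p q < δ := by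
  rw [dist_pi_lt_iff hδ]
  intro y
  rw [Real.dist_eq]
  refine abs_lt_of_sq_lt_sq ?_ hδ.le
  linarith [sq_sub_le_klSum hp hq hqf y]

theorem tendsto_klSum {Y X : Type*} [Fintype Y] {l : Filter X} {f g : X → Y → ℝ} {p q : Y → ℝ}
    (hf : Tendsto f l (𝓝 p)) (hg : Tendsto g l (𝓝 q)) (hp : ∀ y, 0 < p y) (hq : ∀ y, 0 < q y) :
    Tendsto (fun x => klSum (f x) (g x)) l (𝓝 (klSum p q)) := by
  refine tendsto_finsetSum _ fun y _ => ?_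
  have hfy := tendsto_pi_nhds.1 hf y
  have hgy := tendsto_pi_nhds.1 hg y
  exact hfy.mul ((hfy.div hgy (hq y).ne').log (div_pos (hp y) (hq y)).ne')

/-- Strict comparison of divergences persists near distributions with full support. -/
theorem eventually_KL_lt_KL {Y : Type*} [Fintype Y] {p q r : Y → ℝ} (hp : ∀ y, 0 < p y)
    (hq : ∀ y, 0 < q y) (hr : ∀ y, 0 < r y) (h : KL p q < KL p r) :
    ∀ᶠ x : (Y → ℝ) × (Y → ℝ) × (Y → ℝ) in 𝓝 (p, q, r), KL x.1 x.2.1 < KL x.1 x.2.2 := by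
  have h1 : Tendsto (fun x : (Y → ℝ) × (Y → ℝ) × (Y → ℝ) => x.1) (𝓝 (p, q, r)) (𝓝 p) :=
    continuous_fst.tendsto _
  have h2 : Tendsto (fun x : (Y → ℝ) × (Y → ℝ) × (Y → ℝ) => x.2.1) (𝓝 (p, q, r)) (𝓝 q) :=
    (continuous_fst.comp continuous_snd).tendsto _
  have h3 : Tendsto (fun x : (Y → ℝ) × (Y → ℝ) × (Y → ℝ) => x.2.2) (𝓝 (p, q, r)) (𝓝 r) :=
    (continuous_snd.comp continuous_snd).tendsto _
  rw [KL_eq_klSum p hq, KL_eq_klSum p hr, EReal.coe_lt_coe_iff] at h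
  filter_upwards [(tendsto_klSum h1 h2 hp hq).eventually_lt (tendsto_klSum h1 h3 hp hr) h,
    eventually_all.2 fun y => (tendsto_pi_nhds.1 h2 y).eventually_const_lt (hq y),
    eventually_all.2 fun y => (tendsto_pi_nhds.1 h3 y).eventually_const_lt (hr y)]
    with x hx hx2 hx3
  rw [KL_eq_klSum _ hx2, KL_eq_klSum _ hx3]
  exact_mod_cast hx

theorem eventually_le_add_klSum {Y : Type*} [Fintype Y] [Nonempty Y] {p q r : Y → ℝ}
    (hp : IsPmf p) (hq : IsPmf q) (hr : IsPmf r) (hpf : ∀ y, 0 < p y)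
    (hqf : ∀ y, 0 < q y) (hrf : ∀ y, 0 < r y) (h : KL p q < KL p r) :
    ∀ᶠ ε : ℝ in 𝓝[>] 0, ∀ q1 q2 q3 : Y → ℝ, IsPmf q1 → IsPmf q2 → IsPmf q3 →
      KL q1 q3 < KL q1 q2 → ε ≤ klSum q1 p + klSum q2 q + klSum q3 r := by
  obtain ⟨δ, hδ, hball⟩ := Metric.eventually_nhds_iff.1 (eventually_KL_lt_KL hpf hqf hrf h)
  filter_upwards [Ioo_mem_nhdsGT (show (0 : ℝ) < δ ^ 2 / 4 by positivity)]
    with ε hε q1 q2 q3 h1 h2 h3 hlt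
  by_contra! hsum
  have n1 := klSum_nonneg h1 hp hpf
  have n2 := klSum_nonneg h2 hq hqf
  have n3 := klSum_nonneg h3 hr hrf
  have hεδ := hε.2
  have hdist : dist (q1, q2, q3) (p, q, r) < δ :=
    max_lt (dist_lt_of_klSum_lt h1 hp hpf hδ (by linarith))
      (max_lt (dist_lt_of_klSum_lt h2 hq hqf hδ (by linarith))
        (dist_lt_of_klSum_lt h3 hr hrf hδ (by linarith)))
  exact lt_asymm hlt (hball hdist)

/-- positivity of the exponent α9 under the clustering
condition. The clustering condition states that the KL divergence between any
two distributions within the same cluster (outlying cluster `{μ i}_{i∈S}` or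
typical cluster `{π j}_{j∈T}`) is strictly less than the KL divergence, in
either direction, between any two distributions in different clusters. Under it,
the stated infimum is strictly positive. -/
theorem alpha9_pos {Y : Type*} [Fintype Y] [Nonempty Y] {ι κ : Type*}
    (S : Finset ι) (hS : S.Nonempty) (T : Finset κ) (hT : T.Nonempty)
    (μ : ι → Y → ℝ) (π : κ → Y → ℝ)
    (hμ : ∀ i ∈ S, IsPmf (μ i)) (hμf : ∀ i ∈ S, ∀ y, 0 < μ i y)
    (hπ : ∀ j ∈ T, IsPmf (π j)) (hπf : ∀ j ∈ T, ∀ y, 0 < π j y)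
    (hclusterμ : ∀ i ∈ S, ∀ i' ∈ S, ∀ i'' ∈ S, ∀ j ∈ T,
      KL (μ i) (μ i') < KL (μ i'') (π j) ∧ KL (μ i) (μ i') < KL (π j) (μ i''))
    (hclusterπ : ∀ j ∈ T, ∀ j' ∈ T, ∀ i ∈ S, ∀ j'' ∈ T,
      KL (π j) (π j') < KL (μ i) (π j'') ∧ KL (π j) (π j') < KL (π j'') (μ i)) :
    0 < sInf {r : EReal | ∃ j1 ∈ T, ∃ j2 ∈ T, ∃ i ∈ S, ∃ q1 q2 q3 : Y → ℝ,
      IsPmf q1 ∧ IsPmf q2 ∧ IsPmf q3 ∧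
      KL q1 q3 < KL q1 q2 ∧
      r = KL q1 (π j1) + KL q2 (π j2) + KL q3 (μ i)} := by
  have hev : ∀ᶠ ε : ℝ in 𝓝[>] 0, ∀ j1 ∈ T, ∀ j2 ∈ T, ∀ i ∈ S, ∀ q1 q2 q3 : Y → ℝ,
      IsPmf q1 → IsPmf q2 → IsPmf q3 → KL q1 q3 < KL q1 q2 →
      ε ≤ klSum q1 (π j1) + klSum q2 (π j2) + klSum q3 (μ i) :=
    (Finset.eventually_all T).2 fun j1 hj1 => (Finset.eventually_all T).2 fun j2 hj2 =>
      (Finset.eventually_all S).2 fun i hi =>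
        eventually_le_add_klSum (hπ j1 hj1) (hπ j2 hj2) (hμ i hi) (hπf j1 hj1) (hπf j2 hj2)
          (hμf i hi) (hclusterπ j1 hj1 j2 hj2 i hi j1 hj1).2
  obtain ⟨ε, hε, hεpos⟩ := (hev.and self_mem_nhdsWithin).exists
  refine (EReal.coe_pos.2 hεpos).trans_le (le_sInf ?_)
  rintro _ ⟨j1, hj1, j2, hj2, i, hi, q1, q2, q3, h1, h2, h3, hlt, rfl⟩
  rw [KL_eq_klSum q1 (hπf j1 hj1), KL_eq_klSum q2 (hπf j2 hj2), KL_eq_klSum q3 (hμf i hi)]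
  exact_mod_cast hε j1 hj1 j2 hj2 i hi q1 q2 q3 h1 h2 h3 hlt
end
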